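/- (Lemma 2) For any edge a = [uv] ∈ K^1(P) and any tetrahedra σ, σ̃ ∈ K^3(P) incident to a, the equality J(u,σ) + J(v,σ) = J(u,σ̃) + J(v,σ̃) holds, where J is the function on vertex–tetrahedron pairs produced by Algorithm 2 for the 2-cycle x. Consequently the value J_x(a) defined in step 3 of Algorithm 2 does not depend on the choice of the tetrahedron σ incident to a. -/

import Mathlib

/-!
Framework: the mod-2 simplicial (co)chain complex of a finite simplicial complex
triangulating a closed 3-dimensional manifold, together with its barycentric
subdivision, barycentric stars, and the algorithms of the paper.
-/

noncomputable section

open Finset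

attribute [local instance] Classical.propDecidable

/-- A combinatorial encoding of a finite simplicial complex `K(P)` triangulating a closed
3-dimensional manifold `P`: the four kinds of simplices with their incidence relations,
together with the combinatorial and topological properties of such triangulations that
are used in the paper (purity, each triangle lies in exactly two tetrahedra, strong
connectedness of vertex- and edge-stars, and homological triviality of vertex stars). -/
structure Tri3 where
  (V E T Tet : Type)
  [fV : Fintype V] [fE : Fintype E] [fT : Fintype T] [fTet : Fintype Tet]
  [dV : DecidableEq V] [dE : DecidableEq E] [dT : DecidableEq T] [dTet : DecidableEq Tet]
  vinE : V → E → Prop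
  vinT : V → T → Prop
  vinTet : V → Tet → Prop
  einT : E → T → Prop
  einTet : E → Tet → Prop
  tinTet : T → Tet → Prop
  vinT_of : ∀ {v e t}, vinE v e → einT e t → vinT v t
  vinTet_of : ∀ {v t σ}, vinT v t → tinTet t σ → vinTet v σ
  einTet_of : ∀ {e t σ}, einT e t → tinTet t σ → einTet e σ
  vinTet_of' : ∀ {v e σ}, vinE v e → einTet e σ → vinTet v σ
  edge_unique : ∀ {u v e e'}, u ≠ v → vinE u e → vinE v e → vinE u e' → vinE v e' → e = e'
  edge_card : ∀ e, Nat.card {v // vinE v e} = 2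
  tri_vcard : ∀ t, Nat.card {v // vinT v t} = 3
  tri_ecard : ∀ t, Nat.card {e // einT e t} = 3
  tet_vcard : ∀ σ, Nat.card {v // vinTet v σ} = 4
  tet_tcard : ∀ σ, Nat.card {t // tinTet t σ} = 4
  uniform_v : ∀ v, ∃ e, vinE v e
  uniform_e : ∀ e, ∃ t, einT e t
  uniform_t : ∀ t, ∃ σ, tinTet t σ
  closed_t : ∀ t, Nat.card {σ // tinTet t σ} = 2
  star_conn : ∀ v σ σ', vinTet v σ → vinTet v σ' →
    Relation.ReflTransGen (fun a b => ∃ t, vinT v t ∧ tinTet t a ∧ tinTet t b ∧ a ≠ b) σ σ'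
  edgestar_conn : ∀ e σ σ', einTet e σ → einTet e σ' →
    Relation.ReflTransGen (fun a b => ∃ t, einT e t ∧ tinTet t a ∧ tinTet t b ∧ a ≠ b) σ σ'
  star_acyclic : ∀ (v : V) (x : T → ZMod 2),
    (∀ e : E, (∑ t : T, if einT e t then x t else 0) = 0) →
    ∀ (q : ℕ) (σs : ℕ → Tet) (ts : ℕ → T), σs q = σs 0 →
      (∀ i ≤ q, vinTet v (σs i)) →
      (∀ i < q, vinT v (ts i) ∧ tinTet (ts i) (σs i) ∧ tinTet (ts i) (σs (i + 1)) ∧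
        σs i ≠ σs (i + 1)) →
      (∑ i ∈ Finset.range q, x (ts i)) = 0

attribute [instance] Tri3.fV Tri3.fE Tri3.fT Tri3.fTet Tri3.dV Tri3.dE Tri3.dT Tri3.dTet

/-- The `n`-simplices `K^n(P)` (an empty type above dimension 3). -/
def Tri3.S (P : Tri3) : ℕ → Type
  | 0 => P.V
  | 1 => P.E
  | 2 => P.T
  | 3 => P.Tet
  | _ + 4 => PEmpty

instance Tri3.instFintypeS (P : Tri3) : ∀ n, Fintype (P.S n)
  | 0 => P.fV
  | 1 => P.fE
  | 2 => P.fT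
  | 3 => P.fTet
  | _ + 4 => inferInstanceAs (Fintype PEmpty)

instance Tri3.instDecEqS (P : Tri3) : ∀ n, DecidableEq (P.S n)
  | 0 => P.dV
  | 1 => P.dE
  | 2 => P.dT
  | 3 => P.dTet
  | _ + 4 => inferInstanceAs (DecidableEq PEmpty)

/-- Mod-2 simplicial chains `C_n(P)` (identified, as usual, with cochains `C^n(P)` and with
sets of `n`-simplices). -/
abbrev Ch (P : Tri3) (n : ℕ) : Type := P.S n → ZMod 2

/-- The linear map sending a chain `c` to `b ↦ ∑ (a incident to b), c a`. -/
def incMap {A B : Type} [Fintype A] (R : B → A → Prop) :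
    (A → ZMod 2) →ₗ[ZMod 2] (B → ZMod 2) where
  toFun c := fun b => ∑ a : A, if R b a then c a else 0
  map_add' c₁ c₂ := by
    funext b
    show _ = (∑ a : A, if R b a then c₁ a else 0) + (∑ a : A, if R b a then c₂ a else 0)
    rw [← Finset.sum_add_distrib]
    exact Finset.sum_congr rfl fun a _ => by by_cases h : R b a <;> simp [h]
  map_smul' r c := by
    funext b
    show _ = r • (∑ a : A, if R b a then c a else 0)
    rw [smul_eq_mul, Finset.mul_sum]
    exact Finset.sum_congr rfl fun a _ => by by_cases h : R b a <;> simp [h]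

/-- The mod-2 boundary operator `∂ : C_n(P) → C_{n-1}(P)`. -/
def Tri3.dTo (P : Tri3) : (n : ℕ) → Ch P n →ₗ[ZMod 2] Ch P (n - 1)
  | 0 => 0
  | 1 => incMap fun v e => P.vinE v e
  | 2 => incMap fun e t => P.einT e t
  | 3 => incMap fun t σ => P.tinTet t σ
  | _ + 4 => 0

/-- The mod-2 coboundary operator `δ : C^{n-1}(P) → C^n(P)` (the transpose of `∂`). -/
def Tri3.cobTo (P : Tri3) : (n : ℕ) → Ch P (n - 1) →ₗ[ZMod 2] Ch P n
  | 0 => 0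
  | 1 => incMap fun e v => P.vinE v e
  | 2 => incMap fun t e => P.einT e t
  | 3 => incMap fun σ t => P.tinTet t σ
  | _ + 4 => 0

/-- The quotient `C_n(P)/B_n(P)` of chains modulo boundaries; homology classes of cycles are
compared inside it. -/
abbrev Hq (P : Tri3) (n : ℕ) : Type := Ch P n ⧸ LinearMap.range (P.dTo (n + 1))

/-- The class of a chain modulo boundaries. -/
def hclass (P : Tri3) (n : ℕ) (c : Ch P n) : Hq P n := Submodule.Quotient.mk c

/-- Cycles `Z_n(P)`. -/
def Zmod (P : Tri3) (n : ℕ) : Submodule (ZMod 2) (Ch P n) := LinearMap.ker (P.dTo n)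

/-- Boundaries `B_n(P)`. -/
def Bmod (P : Tri3) (n : ℕ) : Submodule (ZMod 2) (Ch P n) := LinearMap.range (P.dTo (n + 1))

/-- The simplicial homology group `H_n(P)` with coefficients in `ℤ/2`. -/
abbrev Hmod (P : Tri3) (n : ℕ) : Type :=
  (Zmod P n) ⧸ (Submodule.comap (Zmod P n).subtype (Bmod P n))

/-- The homology class `[c] ∈ H_n(P)` of a cycle `c`. -/
def zclass (P : Tri3) (n : ℕ) (c : Ch P n) (hc : c ∈ Zmod P n) : Hmod P n :=
  Submodule.Quotient.mk ⟨c, hc⟩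

/-- Cocycles `Z^n(P)`. -/
def Zco (P : Tri3) (n : ℕ) : Submodule (ZMod 2) (Ch P n) := LinearMap.ker (P.cobTo (n + 1))

/-- Coboundaries `B^n(P)`. -/
def Bco (P : Tri3) (n : ℕ) : Submodule (ZMod 2) (Ch P n) := LinearMap.range (P.cobTo n)

/-- The simplicial cohomology group `H^n(P)` with coefficients in `ℤ/2`. -/
abbrev Hcomod (P : Tri3) (n : ℕ) : Type :=
  (Zco P n) ⧸ (Submodule.comap (Zco P n).subtype (Bco P n))

/-- The cohomology class `[J] ∈ H^n(P)` of a cocycle `J`. -/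
def cclass (P : Tri3) (n : ℕ) (c : Ch P n) (hc : c ∈ Zco P n) : Hcomod P n :=
  Submodule.Quotient.mk ⟨c, hc⟩

/-- Evaluation `J(y)` of a cochain `J` on a chain `y`. -/
def evalC {S : Type} [Fintype S] (J : S → ZMod 2) (c : S → ZMod 2) : ZMod 2 :=
  ∑ s : S, c s * J s

/-- The intersection number `I(x*, y)` of the star chain `x* = ∑ g(σ)·bst(σ,P)` with the
simplicial chain `y`, i.e. `∑_{σ} g(σ)·y(σ)`. -/
def Ipair {S : Type} [Fintype S] (g : S → ZMod 2) (y : S → ZMod 2) : ZMod 2 :=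
  ∑ s : S, g s * y s

/-- The chain consisting of the single simplex `s`. -/
def unitChain {S : Type} [DecidableEq S] (s : S) : S → ZMod 2 := fun t => if t = s then 1 else 0

/-- The barycentric subdivision `K'(P)` of `K(P)`: the subdivided complex `Pb`, the inclusion of
vertices, the subdivision chain maps `C_n(P) → C_n(K'(P))`, and the barycentric star chains
`bst(σ,P) ∈ C_{3-n}(K'(P))` of the `n`-simplices `σ` of `K(P)`. -/
structure Subdiv (P : Tri3) where
  Pb : Tri3
  vmap : P.V → Pb.V
  subdiv : (n : ℕ) → Ch P n →ₗ[ZMod 2] Ch Pb n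
  bst : (n : ℕ) → P.S n → Ch Pb (3 - n)

/-- The Poincaré map `F : C^l(P) → C_{3-l}(K'(P))`, `F(J) = ∑_σ J(σ)·bst(σ,P)`. -/
def Fchain {P : Tri3} (SD : Subdiv P) (l : ℕ) (J : Ch P l) : Ch SD.Pb (3 - l) :=
  fun s => ∑ σ : P.S l, J σ * SD.bst l σ s

/-- The data produced by (and the input of) Algorithm 1 for a 1-cycle
`x = [v_0,v_1] + ⋯ + [v_{n-1},v_n]` (`v_n = v_0`, pairwise distinct edges `e i = [v_i, v_{i+1}]`):
a tetrahedron `σ i` incident to each edge `e i` (with `σ n = σ 0`), and for each `i` a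
3-dimensional path `pth i 0, …, pth i (k i)` in the star of the vertex `v (i+1)` from `σ i` to
`σ (i+1)`, consecutive tetrahedra of which share the common triangle `tri i j`. -/
structure Alg1Data (P : Tri3) (x : Ch P 1) where
  n : ℕ
  npos : 0 < n
  v : ℕ → P.V
  e : ℕ → P.E
  hcyc : v n = v 0
  einj : ∀ i < n, ∀ j < n, e i = e j → i = j
  hx : ∀ a : P.E, x a = ∑ i ∈ Finset.range n, (if e i = a then 1 else 0)
  hve : ∀ i < n, P.vinE (v i) (e i)
  hve' : ∀ i < n, P.vinE (v (i + 1)) (e i)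
  hvne : ∀ i < n, v i ≠ v (i + 1)
  σ : ℕ → P.Tet
  hσcyc : σ n = σ 0
  hσ : ∀ i < n, P.einTet (e i) (σ i)
  k : ℕ → ℕ
  pth : ℕ → ℕ → P.Tet
  tri : ℕ → ℕ → P.T
  hstart : ∀ i < n, pth i 0 = σ i
  hend : ∀ i < n, pth i (k i) = σ (i + 1)
  hstar : ∀ i < n, ∀ j ≤ k i, P.vinTet (v (i + 1)) (pth i j)
  hadj : ∀ i < n, ∀ j < k i, P.tinTet (tri i j) (pth i j) ∧ P.tinTet (tri i j) (pth i (j + 1)) ∧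
    pth i j ≠ pth i (j + 1)

/-- The cochain `J_x : K^2(P) → ℤ/2` produced by Algorithm 1: `J_x(t)` is the number modulo 2
of pairs `(i,j)` with `tri i j = t`. -/
def Alg1Data.Jx {P : Tri3} {x : Ch P 1} (d : Alg1Data P x) : Ch P 2 :=
  fun t => ∑ i ∈ Finset.range d.n, ∑ j ∈ Finset.range (d.k i), (if d.tri i j = t then 1 else 0)

/-- `v ∈ K^0(|x|)`: the vertex `v` belongs to the body of the 2-chain `x`. -/
def VinSupp (P : Tri3) (x : Ch P 2) (v : P.V) : Prop := ∃ t, x t ≠ 0 ∧ P.vinT v t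

/-- `J : TP → ℤ/2` is an output of Algorithm 2 for the 2-cycle `x`: it vanishes for
`v ∉ K^0(|x|)`, and for `v ∈ K^0(|x|)` it is obtained from a starting tetrahedron `σ₀` of the
star of `v` (with `J(v,σ₀) = 0`) by propagating along 3-dimensional paths in the star of `v`,
the value jumping by `x(t)` when crossing a triangle `t`. -/
structure Alg2Output (P : Tri3) (x : Ch P 2) (J : P.V → P.Tet → ZMod 2) : Prop where
  zero_off : ∀ v σ, ¬ VinSupp P x v → J v σ = 0
  paths : ∀ v, VinSupp P x v → ∃ σ₀, P.vinTet v σ₀ ∧ J v σ₀ = 0 ∧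
    ∀ θ, P.vinTet v θ → ∃ (q : ℕ) (σs : ℕ → P.Tet) (ts : ℕ → P.T),
      σs 0 = σ₀ ∧ σs q = θ ∧ (∀ i ≤ q, P.vinTet v (σs i)) ∧
      (∀ i < q, P.vinT v (ts i) ∧ P.tinTet (ts i) (σs i) ∧ P.tinTet (ts i) (σs (i + 1)) ∧
        σs i ≠ σs (i + 1)) ∧
      (∀ i < q, J v (σs (i + 1)) = J v (σs i) + x (ts i))

/-- `Jx : K^1(P) → ℤ/2` is the cochain produced by step 3 of Algorithm 2 from `J`:
for each edge `a = [uv]` one chooses an arbitrary incident tetrahedron `σ` and sets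
`J_x(a) = J(u,σ) + J(v,σ)`. -/
def IsAlg2Jx (P : Tri3) (J : P.V → P.Tet → ZMod 2) (Jx : Ch P 1) : Prop :=
  ∀ a : P.E, ∃ u v σ, u ≠ v ∧ P.vinE u a ∧ P.vinE v a ∧ P.einTet a σ ∧
    Jx a = J u σ + J v σ

/-- The 2-chain `z₀ = ∑_{v ∈ K^0(|x|)} ∑_{σ ∈ T⁺(v)} bk'(v,σ)` of `K'(P)`. -/
def z0chain {P : Tri3} (SD : Subdiv P) (x : Ch P 2) (J : P.V → P.Tet → ZMod 2)
    (bk' : P.V → P.Tet → Ch SD.Pb 2) : Ch SD.Pb 2 :=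
  fun s => ∑ v : P.V, ∑ σ : P.Tet,
    if VinSupp P x v ∧ P.vinTet v σ ∧ J v σ = 1 then bk' v σ s else 0

/-- The 2-chain `z₁ = ∑_{v ∈ K^0(|x|)} ∑_{σ ∈ T⁺(v)} lk'(v,σ)` of `K'(P)`. -/
def z1chain {P : Tri3} (SD : Subdiv P) (x : Ch P 2) (J : P.V → P.Tet → ZMod 2)
    (lk' : P.V → P.Tet → Ch SD.Pb 2) : Ch SD.Pb 2 :=
  fun s => ∑ v : P.V, ∑ σ : P.Tet,
    if VinSupp P x v ∧ P.vinTet v σ ∧ J v σ = 1 then lk' v σ s else 0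

/-- The star 2-chain `x* = ∑_{a ∈ K^{1+}(P,x)} bst(a,P)` of `K'(P)`. -/
def xstarChain {P : Tri3} (SD : Subdiv P) (Jx : Ch P 1) : Ch SD.Pb 2 :=
  fun s => ∑ a : P.E, if Jx a = 1 then SD.bst 1 a s else 0

/-- The vertex set `V̂ = K^0(P) × (ℤ/2)^r` of the covering polyhedron `P̂`. -/
abbrev Vhat (P : Tri3) (r : ℕ) : Type := P.V × (Fin r → ZMod 2)

/-- The simplices of `K(P)` as sets of vertices. -/
def Ksets (P : Tri3) : Set (Finset P.V) :=
  {s | (∃ v, s = {v}) ∨ (∃ e, s = Finset.univ.filter fun v => P.vinE v e) ∨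
       (∃ t, s = Finset.univ.filter fun v => P.vinT v t) ∨
       (∃ σ, s = Finset.univ.filter fun v => P.vinTet v σ)}

/-- The index vector `J(c) = (J^1(c), …, J^r(c))` of a 1-chain `c`. -/
def Jvec {P : Tri3} {r : ℕ} (Jc : Fin r → Ch P 1) (c : Ch P 1) : Fin r → ZMod 2 :=
  fun i => evalC (Jc i) c

/-- The simplicial scheme `K̂` on `V̂`: a set `ŝ` of vertices of `V̂` spans a simplex iff it
projects bijectively onto a simplex of `K(P)` and the second components satisfy
`k₂ = k₁ + J([v₁v₂])` for each edge `[v₁v₂]` of that simplex. -/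
def Khat (P : Tri3) {r : ℕ} (Jc : Fin r → Ch P 1) : Set (Finset (Vhat P r)) :=
  {s | (s.image Prod.fst ∈ Ksets P) ∧ s.card = (s.image Prod.fst).card ∧
    ∀ p₁ ∈ s, ∀ p₂ ∈ s, p₁.1 ≠ p₂.1 → ∀ e : P.E, P.vinE p₁.1 e → P.vinE p₂.1 e →
      p₂.2 = p₁.2 + Jvec Jc (unitChain e)}

/-- A deck transformation of the covering `p : P̂ → P`: a permutation of `V̂` over `K^0(P)`
preserving the simplicial scheme `K̂`. -/
def IsDeck (P : Tri3) {r : ℕ} (Jc : Fin r → Ch P 1) (g : Equiv.Perm (Vhat P r)) : Prop :=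
  (∀ a, (g a).1 = a.1) ∧ ∀ s : Finset (Vhat P r), s ∈ Khat P Jc ↔ s.image g ∈ Khat P Jc

/-- A simplicial path `y = [w₀w₁] + ⋯ + [w_{q-1}w_q]` in `P`. -/
structure PathIn (P : Tri3) where
  q : ℕ
  w : ℕ → P.V
  e : ℕ → P.E
  hve : ∀ i < q, P.vinE (w i) (e i)
  hve' : ∀ i < q, P.vinE (w (i + 1)) (e i)
  hne : ∀ i < q, w i ≠ w (i + 1)

/-- The 1-chain `[w₀w₁] + ⋯ + [w_{j-1}w_j]` of the first `j` edges of a path. -/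
def PathIn.chainTo {P : Tri3} (γ : PathIn P) (j : ℕ) : Ch P 1 :=
  fun a => ∑ i ∈ Finset.range j, if γ.e i = a then 1 else 0

/-- The 1-chain of a path. -/
def PathIn.chain {P : Tri3} (γ : PathIn P) : Ch P 1 := γ.chainTo γ.q

/-- `wh` is a lift of the path `γ` to `P̂` starting at `(γ.w 0, k₀)`: it covers `γ` and
consecutive vertices span 1-simplices of `K̂`. -/
def IsLift (P : Tri3) {r : ℕ} (Jc : Fin r → Ch P 1) (γ : PathIn P) (k0 : Fin r → ZMod 2)
    (wh : ℕ → Vhat P r) : Prop :=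
  wh 0 = (γ.w 0, k0) ∧ (∀ i ≤ γ.q, (wh i).1 = γ.w i) ∧
  ∀ i < γ.q, ({wh i, wh (i + 1)} : Finset (Vhat P r)) ∈ Khat P Jc

/-- A simplicial path in the covering polyhedron `P̂`, recorded together with the edges of
`P` that it covers. -/
structure PathHat (P : Tri3) {r : ℕ} (Jc : Fin r → Ch P 1) where
  q : ℕ
  w : ℕ → Vhat P r
  e : ℕ → P.E
  hve : ∀ i < q, P.vinE (w i).1 (e i)
  hve' : ∀ i < q, P.vinE (w (i + 1)).1 (e i)
  hne : ∀ i < q, (w i).1 ≠ (w (i + 1)).1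
  hK : ∀ i < q, ({w i, w (i + 1)} : Finset (Vhat P r)) ∈ Khat P Jc

/-- The 1-chain of `P` covered by a path of `P̂` (the image chain `p(ẑ)`). -/
def PathHat.projChain {P : Tri3} {r : ℕ} {Jc : Fin r → Ch P 1} (γ : PathHat P Jc) : Ch P 1 :=
  fun a => ∑ i ∈ Finset.range γ.q, if γ.e i = a then 1 else 0

/-- `P.StarPath v x σ θ s`: some 3-dimensional path in the star of `v` from `σ` to `θ` crosses
triangles whose `x`-values sum to `s`. -/
inductive Tri3.StarPath (P : Tri3) (v : P.V) (x : P.T → ZMod 2) :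
    P.Tet → P.Tet → ZMod 2 → Prop
  | nil {σ : P.Tet} (hσ : P.vinTet v σ) : P.StarPath v x σ σ 0
  | cons {σ τ θ : P.Tet} {t : P.T} {s : ZMod 2} (ht : P.vinT v t) (hσ : P.tinTet t σ)
      (hτ : P.tinTet t τ) (hne : σ ≠ τ) (h : P.StarPath v x τ θ s) : P.StarPath v x σ θ (x t + s)

namespace Tri3.StarPath

variable {P : Tri3} {v : P.V} {x : P.T → ZMod 2}

theorem trans {σ τ θ : P.Tet} {s s' : ZMod 2} (h : P.StarPath v x σ τ s)
    (h' : P.StarPath v x τ θ s') : P.StarPath v x σ θ (s + s') := by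
  induction h with
  | nil _ => simpa using h'
  | cons ht hσ hτ hne _ ih => simpa only [add_assoc] using cons ht hσ hτ hne (ih h')

theorem single {σ τ : P.Tet} {t : P.T} (ht : P.vinT v t) (hσ : P.tinTet t σ)
    (hτ : P.tinTet t τ) (hne : σ ≠ τ) : P.StarPath v x σ τ (x t) := by
  simpa using cons (x := x) ht hσ hτ hne (nil (P.vinTet_of ht hτ))

theorem symm {σ τ : P.Tet} {s : ZMod 2} (h : P.StarPath v x σ τ s) :
    P.StarPath v x τ σ s := by
  induction h with
  | nil hσ => exact nil hσ
  | cons ht hσ hτ hne _ ih => simpa only [add_comm] using ih.trans (single ht hτ hσ hne.symm)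

theorem of_seq (σs : ℕ → P.Tet) (ts : ℕ → P.T) (q : ℕ) (hmem : ∀ i ≤ q, P.vinTet v (σs i))
    (hstep : ∀ i < q, P.vinT v (ts i) ∧ P.tinTet (ts i) (σs i) ∧ P.tinTet (ts i) (σs (i + 1)) ∧
      σs i ≠ σs (i + 1)) :
    P.StarPath v x (σs 0) (σs q) (∑ i ∈ Finset.range q, x (ts i)) := by
  induction q with
  | zero => simpa using nil (hmem 0 le_rfl)
  | succ q ih =>
    obtain ⟨ht, h₁, h₂, hne⟩ := hstep q q.lt_succ_self
    rw [Finset.sum_range_succ]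
    exact (ih (fun i hi => hmem i (by omega)) fun i hi => hstep i (by omega)).trans
      (single ht h₁ h₂ hne)

theorem exists_seq [Nonempty P.T] {σ τ : P.Tet} {s : ZMod 2} (h : P.StarPath v x σ τ s) :
    ∃ (q : ℕ) (σs : ℕ → P.Tet) (ts : ℕ → P.T), σs 0 = σ ∧ σs q = τ ∧
      (∀ i ≤ q, P.vinTet v (σs i)) ∧
      (∀ i < q, P.vinT v (ts i) ∧ P.tinTet (ts i) (σs i) ∧ P.tinTet (ts i) (σs (i + 1)) ∧
        σs i ≠ σs (i + 1)) ∧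
      ∑ i ∈ Finset.range q, x (ts i) = s := by
  induction h with
  | @nil σ hσ =>
    exact ⟨0, fun _ => σ, fun _ => Classical.arbitrary _, rfl, rfl, fun _ _ => hσ,
      fun _ hi => absurd hi (Nat.not_lt_zero _), by simp⟩
  | @cons σ τ θ t s ht hσ hτ hne _ ih =>
    obtain ⟨q, σs, ts, h0, hq, hmem, hstep, hsum⟩ := ih
    refine ⟨q + 1, fun i => i.casesOn σ σs, fun i => i.casesOn t ts, rfl, hq, ?_, ?_, ?_⟩
    · rintro (_ | i) hi
      · exact P.vinTet_of ht hσ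
      · exact hmem i (by omega)
    · rintro (_ | i) hi
      · subst h0
        exact ⟨ht, hσ, hτ, hne⟩
      · exact hstep i (by omega)
    · rw [Finset.sum_range_succ', add_comm, ← hsum]
      rfl

theorem eq_zero (hx : P.dTo 2 x = 0) {σ : P.Tet} {s : ZMod 2} (h : P.StarPath v x σ σ s) :
    s = 0 := by
  by_cases hT : Nonempty P.T
  · obtain ⟨q, σs, ts, h0, hq, hmem, hstep, rfl⟩ := h.exists_seq
    exact P.star_acyclic v x (fun e => congrFun hx e) q σs ts (hq.trans h0.symm) hmem hstep
  · cases h with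
    | nil _ => rfl
    | @cons _ _ _ t => exact absurd ⟨t⟩ hT

end Tri3.StarPath

/-- An output of Algorithm 2 jumps by `x t` across every triangle `t` containing the vertex. -/
theorem Alg2Output.eq_add {P : Tri3} {x : Ch P 2} {J : P.V → P.Tet → ZMod 2}
    (hJ : Alg2Output P x J) (hx : P.dTo 2 x = 0) {v : P.V} {t : P.T} {σ τ : P.Tet}
    (ht : P.vinT v t) (hσ : P.tinTet t σ) (hτ : P.tinTet t τ) (hne : σ ≠ τ) :
    J v τ = J v σ + x t := by
  by_cases hv : VinSupp P x v
  · obtain ⟨σ₀, -, hσ₀, hpath⟩ := hJ.paths v hv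
    have key (θ : P.Tet) (hθ : P.vinTet v θ) : P.StarPath v x σ₀ θ (J v θ) := by
      obtain ⟨q, σs, ts, rfl, rfl, hmem, hstep, hjump⟩ := hpath θ hθ
      have hsum : ∀ k ≤ q, ∑ i ∈ Finset.range k, x (ts i) = J v (σs k) := by
        intro k hk
        induction k with
        | zero => simp [hσ₀]
        | succ k ih => rw [Finset.sum_range_succ, ih (by omega), hjump k (by omega)]
      rw [← hsum q le_rfl]
      exact Tri3.StarPath.of_seq σs ts q hmem hstep
    have h0 := (((key σ (P.vinTet_of ht hσ)).trans (.single ht hσ hτ hne)).trans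
      (key τ (P.vinTet_of ht hτ)).symm).eq_zero hx
    exact (CharTwo.add_eq_zero.mp h0).symm
  · have hxt : x t = 0 := by_contra fun h => hv ⟨t, h, ht⟩
    rw [hJ.zero_off v σ hv, hJ.zero_off v τ hv, hxt, add_zero]

/-- The sum of an output of Algorithm 2 over two vertices of an edge is constant on the star of
that edge. -/
theorem Alg2Output.add_eq_add {P : Tri3} {x : Ch P 2} {J : P.V → P.Tet → ZMod 2}
    (hJ : Alg2Output P x J) (hx : P.dTo 2 x = 0) {a : P.E} {u v : P.V} (hu : P.vinE u a)
    (hv : P.vinE v a) {σ τ : P.Tet} (hσ : P.einTet a σ) (hτ : P.einTet a τ) :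
    J u σ + J v σ = J u τ + J v τ := by
  induction P.edgestar_conn a σ τ hσ hτ with
  | refl => rfl
  | tail _ hstep ih =>
    obtain ⟨t, ht, h₁, h₂, hne⟩ := hstep
    rw [ih (P.einTet_of ht h₁), hJ.eq_add hx (P.vinT_of hu ht) h₁ h₂ hne,
      hJ.eq_add hx (P.vinT_of hv ht) h₁ h₂ hne, add_add_add_comm, CharTwo.add_self_eq_zero,
      add_zero]

/-- **Lemma 2.** For any edge `a = [uv] ∈ K^1(P)` and any tetrahedra
`σ, σ̃ ∈ K^3(P)` incident to `a`, `J(u,σ) + J(v,σ) = J(u,σ̃) + J(v,σ̃)`, where `J` is the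
function produced by Algorithm 2 for the 2-cycle `x`.  Consequently the value
`J_x(a) = J(u,σ) + J(v,σ)` defined in step 3 of Algorithm 2 does not depend on the choice of
the tetrahedron `σ` incident to `a`. -/
theorem stmt_7 (P : Tri3) (x : Ch P 2) (hx : P.dTo 2 x = 0)
    (J : P.V → P.Tet → ZMod 2) (hJ : Alg2Output P x J)
    (a : P.E) (u v : P.V) (huv : u ≠ v) (hu : P.vinE u a) (hv : P.vinE v a)
    (σ σ' : P.Tet) (hσ : P.einTet a σ) (hσ' : P.einTet a σ') :
    J u σ + J v σ = J u σ' + J v σ' ∧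
    (∀ b b' : ZMod 2, (∃ θ, P.einTet a θ ∧ b = J u θ + J v θ) →
      (∃ θ, P.einTet a θ ∧ b' = J u θ + J v θ) → b = b') := by
  refine ⟨hJ.add_eq_add hx hu hv hσ hσ', ?_⟩
  rintro _ _ ⟨θ, hθ, rfl⟩ ⟨θ', hθ', rfl⟩
  exact hJ.add_eq_add hx hu hv hθ hθ'
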